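/- Let h be an entropy function of the category of left A-modules and M an A-module. Then h(P_h(M)) = 0, and P_h(M) is the greatest submodule of M on which h vanishes: every submodule L of M with h(L) = 0 satisfies L ⊆ P_h(M). -/

import Mathlib

open DirectSum

/-- An invariant of the category of left `A`-modules: a function assigning to every
left `A`-module a value in `[0,∞]`. -/
abbrev ModuleInvariant (A : Type) [Ring A] : Type 1 :=
  ∀ (M : Type) [AddCommGroup M] [Module A M], ENNReal

/-- `h` is an entropy function of the category of left `A`-modules: it satisfies
(A1) vanishing on zero modules and invariance under isomorphism, (A2) `h M = 0` iff
`h` vanishes on every submodule and every quotient of `M`, and (A3) `h` vanishes on a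
direct sum iff it vanishes on every summand. -/
def IsEntropyFunction (A : Type) [Ring A] (h : ModuleInvariant A) : Prop :=
  (∀ (M : Type) [AddCommGroup M] [Module A M], Subsingleton M → h M = 0) ∧
  (∀ (M : Type) [AddCommGroup M] [Module A M] (N : Type) [AddCommGroup N] [Module A N],
      Nonempty (M ≃ₗ[A] N) → h M = h N) ∧
  (∀ (M : Type) [AddCommGroup M] [Module A M],
      h M = 0 ↔ ∀ N : Submodule A M, h ↥N = 0 ∧ h (M ⧸ N) = 0) ∧
  (∀ (J : Type) (M : J → Type) [∀ j, AddCommGroup (M j)] [∀ j, Module A (M j)],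
      h (⨁ j, M j) = 0 ↔ ∀ j, h (M j) = 0)

/-- The Pinsker radical of an invariant `h`: the sum (join) of all submodules on which `h`
vanishes. -/
def PinskerRadical (A : Type) [Ring A] (h : ModuleInvariant A)
    (M : Type) [AddCommGroup M] [Module A M] : Submodule A M :=
  sSup {N : Submodule A M | h ↥N = 0}

/-- `h` vanishes on the Pinsker radical of `M`, and the Pinsker radical is the greatest
submodule of `M` with this property. -/
theorem pinskerRadical_spec (A : Type) [Ring A] (h : ModuleInvariant A)
    (H : IsEntropyFunction A h) (M : Type) [AddCommGroup M] [Module A M] :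
    h ↥(PinskerRadical A h M) = 0 ∧
    ∀ L : Submodule A M, h ↥L = 0 → L ≤ PinskerRadical A h M := by
  classical
  refine ⟨?_, fun L hL => le_sSup hL⟩
  obtain ⟨-, hiso, hq, hsum⟩ := H
  let J := {N : Submodule A M // h ↥N = 0}
  let f : (⨁ j : J, ↥j.1) →ₗ[A] M := DirectSum.toModule A J M (fun j => j.1.subtype)
  have h0 : h (⨁ j : J, ↥j.1) = 0 := (hsum J (fun j => ↥j.1)).2 (fun j => j.2)
  have hr : LinearMap.range f = PinskerRadical A h M := by
    apply le_antisymm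
    · rintro _ ⟨x, rfl⟩
      induction x using DirectSum.induction_on with
      | zero => rw [map_zero]; exact Submodule.zero_mem _
      | of j x =>
        have e : f (DirectSum.of (fun j : J => ↥j.1) j x) = x.1 :=
          DirectSum.toModule_lof (M := fun j : J => ↥j.1) (φ := fun j : J => j.1.subtype) A j x
        rw [e]
        exact (le_sSup (a := j.1) j.2 : j.1 ≤ PinskerRadical A h M) x.2
      | add x y hx hy => rw [map_add]; exact Submodule.add_mem _ hx hy
    · refine sSup_le fun N hN x hx => ?_
      exact ⟨DirectSum.lof A J (fun j => ↥j.1) ⟨N, hN⟩ ⟨x, hx⟩,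
        DirectSum.toModule_lof A (⟨N, hN⟩ : J) _⟩
  rw [← hr, ← hiso _ _ ⟨f.quotKerEquivRange⟩]
  exact ((hq _).1 h0 _).2
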